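/- (Theorem 1.2 specialized at z_j = 1: multi-dimensional Dousse–Kim generalization) Let r ≥ 1 be an integer, let q ∈ ℂ with 0 < |q| < 1, and let a_1, …, a_r ∈ ℂ with |a_j| < 1 for all j. Then ∏_{j=1}^{r} (-a_j q;q)_∞ / (a_j q;q)_∞ = 1 + Σ_{N=1}^∞ q^{N²} [∏_{j=1}^{r} (-a_j q;q)_{N-1} / (a_j q;q)_{N-1}] · Σ_{i_1+⋯+i_r=N, i_t ≥ 0} [a_1^{i_1}⋯a_r^{i_r} (-1;q)_{i_1}⋯(-1;q)_{i_r} / ((q;q)_{i_1}⋯(q;q)_{i_r})] · (1 + Σ_{s=1}^{r} q^{i_1+⋯+i_{s-1}} (1 + q^{i_s}) · [a_s q^N / (1 - a_s q^N)] · ∏_{k=1}^{s-1} [(1 + a_k q^N)/(1 - a_k q^N)]), where the inner sum ranges over all r-tuples of nonnegative integers summing to N and the outer series converges absolutely; note (-1;q)_0 = 1 and (-1;q)_m = 2∏_{k=1}^{m-1}(1+q^k) for m ≥ 1, and all denominators 1 - a_j q^m (m ≥ 1) are nonzero since |a_j q^m| < 1. -/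

import Mathlib

/-- The finite q-Pochhammer symbol `(a;q)_n = ∏_{k=0}^{n-1} (1 - a q^k)`. -/
noncomputable def qPoch (a q : ℂ) (n : ℕ) : ℂ := ∏ k ∈ Finset.range n, (1 - a * q ^ k)

/-- The infinite q-Pochhammer symbol `(a;q)_∞ = ∏_{k=0}^∞ (1 - a q^k)`. -/
noncomputable def qPochInf (a q : ℂ) : ℂ := ∏' k : ℕ, (1 - a * q ^ k)

/-- The `N`-th summand in Theorem 1.2 specialized at `z_j = 1`. -/
noncomputable def overTermOne (r : ℕ) (q : ℂ) (a : Fin r → ℂ) (N : ℕ) : ℂ :=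
  q ^ (N ^ 2) * (∏ j : Fin r, qPoch (-a j * q) q (N - 1) / qPoch (a j * q) q (N - 1)) *
    ∑ i ∈ Finset.Nat.antidiagonalTuple r N,
      ((∏ t : Fin r, a t ^ i t * qPoch (-1) q (i t)) / ∏ t : Fin r, qPoch q q (i t)) *
        (1 + ∑ s : Fin r, q ^ (∑ t ∈ Finset.Iio s, i t) * (1 + q ^ i s) *
            (a s * q ^ N / (1 - a s * q ^ N)) *
            ∏ k ∈ Finset.Iio s, (1 + a k * q ^ N) / (1 - a k * q ^ N))

open Finset Filter Topology

/-- The coefficient of `x ^ n` in `(-a x;q)_∞ / (a x;q)_∞`. -/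
noncomputable def qBinomCoeff (q a : ℂ) (n : ℕ) : ℂ :=
  a ^ n * qPoch (-1) q n / qPoch q q n

/-- The coefficient of `x ^ n` in `∏ j, (-a j x;q)_∞ / (a j x;q)_∞`. -/
noncomputable def qBinomProdCoeff {r : ℕ} (q : ℂ) (a : Fin r → ℂ) (n : ℕ) : ℂ :=
  ∑ i ∈ Nat.antidiagonalTuple r n, ∏ t, qBinomCoeff q (a t) (i t)

/-- The correction factor of the `N`-th summand, with `q ^ N` replaced by a free variable `x`. -/
noncomputable def corr {r : ℕ} (q : ℂ) (a : Fin r → ℂ) (i : Fin r → ℕ) (x : ℂ) : ℂ :=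
  ∑ s : Fin r, q ^ (∑ t ∈ Iio s, i t) * (1 + q ^ i s) * (a s * x / (1 - a s * x)) *
    ∏ k ∈ Iio s, (1 + a k * x) / (1 - a k * x)

theorem qPoch_succ (a q : ℂ) (n : ℕ) : qPoch a q (n + 1) = qPoch a q n * (1 - a * q ^ n) :=
  prod_range_succ _ _

theorem one_sub_ne_zero_of_norm_lt_one {z : ℂ} (hz : ‖z‖ < 1) : 1 - z ≠ 0 := by
  intro h
  rw [← sub_eq_zero.1 h] at hz
  simp at hz

theorem one_sub_pow_succ_ne_zero {q : ℂ} (hq : ‖q‖ < 1) (n : ℕ) : 1 - q ^ (n + 1) ≠ 0 :=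
  one_sub_ne_zero_of_norm_lt_one (by
    rw [norm_pow]; exact pow_lt_one₀ (norm_nonneg _) hq n.succ_ne_zero)

theorem qBinomCoeff_succ {q : ℂ} (hq : ‖q‖ < 1) (a : ℂ) (n : ℕ) :
    qBinomCoeff q a (n + 1) * (1 - q ^ (n + 1)) = qBinomCoeff q a n * (a * (1 + q ^ n)) := by
  have h : 1 - q * q ^ n ≠ 0 := by
    simpa [pow_succ'] using one_sub_pow_succ_ne_zero hq n
  simp only [qBinomCoeff, qPoch_succ, pow_succ']
  rw [div_mul_eq_mul_div, div_mul_eq_mul_div, ← mul_assoc, mul_div_mul_right _ _ h]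
  ring

theorem prod_sub_one_eq_sum {r : ℕ} (f : Fin r → ℂ) :
    ∏ s, f s - 1 = ∑ s, (∏ k ∈ Iio s, f k) * (f s - 1) := by
  have h := prod_one_add_ordered univ fun s ↦ f s - 1
  simp only [add_sub_cancel] at h
  rw [h, add_sub_cancel_left]
  refine sum_congr rfl fun s _ ↦ ?_
  rw [mul_comm]
  congr 2
  ext; simp

theorem pow_mul_prod_sub_one {r : ℕ} (q : ℂ) (a : Fin r → ℂ) (i : Fin r → ℕ) {x : ℂ}
    (hx : ∀ s, 1 - a s * x ≠ 0) :
    q ^ (∑ t, i t) * ∏ s, (1 + a s * x) / (1 - a s * x) - 1 = corr q a i x -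
      ∑ s, (∏ k ∈ Iio s, q ^ i k * ((1 + a k * x) / (1 - a k * x))) *
        ((1 - q ^ i s) / (1 - a s * x)) := by
  rw [← prod_pow_eq_pow_sum, ← prod_mul_distrib, prod_sub_one_eq_sum, corr,
    ← sum_sub_distrib]
  refine sum_congr rfl fun s _ ↦ ?_
  rw [← prod_pow_eq_pow_sum, prod_mul_distrib]
  have := hx s
  generalize ∏ k ∈ Iio s, (1 + a k * x) / (1 - a k * x) = A
  generalize ∏ k ∈ Iio s, q ^ i k = B
  field_simp
  ring

/-- Lowering the `s`-th entry of a tuple of total weight `n + 1`. -/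
theorem sum_antidiagonalTuple_succ_shift {r : ℕ} {q : ℂ} (hq : ‖q‖ < 1) (a : Fin r → ℂ)
    (n : ℕ) (s : Fin r) (g : (Fin r → ℕ) → ℂ)
    (hg : ∀ i m, g (Function.update i s m) = g i) :
    ∑ i ∈ Nat.antidiagonalTuple r (n + 1),
        (∏ t, qBinomCoeff q (a t) (i t)) * (g i * (1 - q ^ i s)) =
      ∑ i ∈ Nat.antidiagonalTuple r n,
        (∏ t, qBinomCoeff q (a t) (i t)) * (g i * (a s * (1 + q ^ i s))) := by
  symm
  refine sum_of_injOn (fun i ↦ Function.update i s (i s + 1)) ?_ ?_ ?_ ?_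
  · intro i _ j _ h
    ext t
    have h' := congrFun h t
    rcases eq_or_ne t s with rfl | hts
    · simpa using h'
    · simpa [hts] using h'
  · intro i hi
    rw [mem_coe, Nat.mem_antidiagonalTuple] at hi ⊢
    rw [sum_update_of_mem (mem_univ s), ← hi, ← add_sum_erase univ i (mem_univ s),
      sdiff_singleton_eq_erase]
    ring
  · intro i hi hni
    have : i s = 0 := by
      by_contra h0
      refine hni ⟨Function.update i s (i s - 1), ?_, ?_⟩
      · rw [Nat.mem_antidiagonalTuple] at hi
        rw [mem_coe, Nat.mem_antidiagonalTuple]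
        rw [← add_sum_erase univ i (mem_univ s)] at hi
        rw [sum_update_of_mem (mem_univ s), sdiff_singleton_eq_erase]
        omega
      · simp [Nat.sub_add_cancel (Nat.one_le_iff_ne_zero.2 h0)]
    simp [this]
  · intro i _
    rw [hg, Function.update_self, ← mul_prod_erase univ _ (mem_univ s),
      ← mul_prod_erase univ (fun t ↦ qBinomCoeff q (a t) (Function.update i s (i s + 1) t))
        (mem_univ s), Function.update_self]
    have h : ∏ t ∈ univ.erase s, qBinomCoeff q (a t) (Function.update i s (i s + 1) t) =
        ∏ t ∈ univ.erase s, qBinomCoeff q (a t) (i t) :=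
      prod_congr rfl fun t ht ↦ by rw [Function.update_of_ne (ne_of_mem_erase ht)]
    rw [h]
    linear_combination (-(∏ t ∈ univ.erase s, qBinomCoeff q (a t) (i t)) * g i) *
      qBinomCoeff_succ hq (a s) (i s)

theorem prod_mul_truncated_sub_truncated {r : ℕ} {q : ℂ} (hq : ‖q‖ < 1) (a : Fin r → ℂ) {x : ℂ}
    (hx : ∀ s, 1 - a s * x ≠ 0) (n : ℕ) :
    (∏ s, (1 + a s * x) / (1 - a s * x)) *
        ∑ k ∈ range (n + 1), qBinomProdCoeff q a k * (q * x) ^ k -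
      ∑ k ∈ range (n + 1), qBinomProdCoeff q a k * x ^ k =
    x ^ n * ∑ i ∈ Nat.antidiagonalTuple r n,
      (∏ t, qBinomCoeff q (a t) (i t)) * corr q a i x := by
  have key : ∀ n, (q ^ n * ∏ s, (1 + a s * x) / (1 - a s * x) - 1) * qBinomProdCoeff q a n =
      ∑ i ∈ Nat.antidiagonalTuple r n, (∏ t, qBinomCoeff q (a t) (i t)) * corr q a i x -
      ∑ s, ∑ i ∈ Nat.antidiagonalTuple r n, (∏ t, qBinomCoeff q (a t) (i t)) *
        (((∏ k ∈ Iio s, q ^ i k * ((1 + a k * x) / (1 - a k * x))) / (1 - a s * x)) *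
          (1 - q ^ i s)) := by
    intro n
    rw [sum_comm, ← sum_sub_distrib, qBinomProdCoeff, mul_sum]
    refine sum_congr rfl fun i hi ↦ ?_
    rw [← (Nat.mem_antidiagonalTuple.1 hi), pow_mul_prod_sub_one q a i hx, ← mul_sum, sub_mul,
      mul_comm (corr q a i x), mul_comm _ (∏ t, qBinomCoeff q (a t) (i t))]
    congr 2
    exact sum_congr rfl fun s _ ↦ by ring
  induction n with
  | zero =>
    have h := key 0
    have h0 : ∑ s, ∑ i ∈ Nat.antidiagonalTuple r 0, (∏ t, qBinomCoeff q (a t) (i t)) *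
        (((∏ k ∈ Iio s, q ^ i k * ((1 + a k * x) / (1 - a k * x))) / (1 - a s * x)) *
          (1 - q ^ i s)) = 0 := by
      simp [Nat.antidiagonalTuple_zero_right]
    rw [h0] at h
    simp only [zero_add, range_one, sum_singleton, pow_zero]
    linear_combination h
  | succ n ih =>
    have h := key (n + 1)
    have hs : x * ∑ s, ∑ i ∈ Nat.antidiagonalTuple r (n + 1), (∏ t, qBinomCoeff q (a t) (i t)) *
        (((∏ k ∈ Iio s, q ^ i k * ((1 + a k * x) / (1 - a k * x))) / (1 - a s * x)) *
          (1 - q ^ i s)) =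
        ∑ i ∈ Nat.antidiagonalTuple r n, (∏ t, qBinomCoeff q (a t) (i t)) * corr q a i x := by
      have (s : Fin r) := sum_antidiagonalTuple_succ_shift hq a n s
        (fun i ↦ (∏ k ∈ Iio s, q ^ i k * ((1 + a k * x) / (1 - a k * x))) / (1 - a s * x))
        (fun i m ↦ by
          congr 1
          exact prod_congr rfl fun k hk ↦ by rw [Function.update_of_ne (mem_Iio.1 hk).ne])
      rw [sum_congr rfl fun s _ ↦ this s, sum_comm, mul_sum]
      refine sum_congr rfl fun i _ ↦ ?_
      rw [← mul_sum, corr, mul_left_comm, mul_sum]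
      congr 1
      refine sum_congr rfl fun s _ ↦ ?_
      rw [← prod_pow_eq_pow_sum, prod_mul_distrib]
      ring
    rw [sum_range_succ _ (n + 1), sum_range_succ _ (n + 1)]
    linear_combination ih + x ^ (n + 1) * h - x ^ n * hs

/-- The partial product `∏ j, (-a j q;q)_n / (a j q;q)_n`. -/
noncomputable def qPochRatio {r : ℕ} (q : ℂ) (a : Fin r → ℂ) (n : ℕ) : ℂ :=
  ∏ j, qPoch (-a j * q) q n / qPoch (a j * q) q n

theorem qPochRatio_succ {r : ℕ} (q : ℂ) (a : Fin r → ℂ) (n : ℕ) :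
    qPochRatio q a (n + 1) = qPochRatio q a n *
      ∏ s, (1 + a s * q ^ (n + 1)) / (1 - a s * q ^ (n + 1)) := by
  rw [qPochRatio, qPochRatio, ← prod_mul_distrib]
  refine prod_congr rfl fun s _ ↦ ?_
  rw [qPoch_succ, qPoch_succ, mul_div_mul_comm]
  ring

theorem norm_mul_pow_succ_le {q a : ℂ} (hq : ‖q‖ < 1) (ha : ‖a‖ < 1) (n : ℕ) :
    ‖a * q ^ (n + 1)‖ ≤ ‖q‖ := by
  rw [norm_mul, norm_pow, pow_succ]
  have := pow_le_one₀ (n := n) (norm_nonneg q) hq.le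
  calc ‖a‖ * (‖q‖ ^ n * ‖q‖) ≤ 1 * (1 * ‖q‖) := by gcongr
    _ = ‖q‖ := by ring

theorem one_sub_mul_pow_succ_ne_zero {q a : ℂ} (hq : ‖q‖ < 1) (ha : ‖a‖ < 1) (n : ℕ) :
    1 - a * q ^ (n + 1) ≠ 0 :=
  one_sub_ne_zero_of_norm_lt_one ((norm_mul_pow_succ_le hq ha n).trans_lt hq)

/-- The generating function of the `r`-coloured overpartitions with at most `n` parts
larger than `n`. -/
noncomputable def truncatedProd {r : ℕ} (q : ℂ) (a : Fin r → ℂ) (n : ℕ) : ℂ :=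
  qPochRatio q a n * ∑ k ∈ range (n + 1), qBinomProdCoeff q a k * (q ^ (n + 1)) ^ k

theorem overTermOne_succ {r : ℕ} (q : ℂ) (a : Fin r → ℂ) (n : ℕ) :
    overTermOne r q a (n + 1) = q ^ ((n + 1) ^ 2) * qPochRatio q a n *
      ∑ i ∈ Nat.antidiagonalTuple r (n + 1),
        (∏ t, qBinomCoeff q (a t) (i t)) * (1 + corr q a i (q ^ (n + 1))) := by
  simp only [overTermOne, corr, qBinomCoeff, prod_div_distrib, qPochRatio, Nat.add_sub_cancel]

theorem overTermOne_succ_eq_sub {r : ℕ} {q : ℂ} (hq : ‖q‖ < 1) {a : Fin r → ℂ}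
    (ha : ∀ j, ‖a j‖ < 1) (n : ℕ) :
    overTermOne r q a (n + 1) = truncatedProd q a (n + 1) - truncatedProd q a n := by
  have h := prod_mul_truncated_sub_truncated hq a
    (fun s ↦ one_sub_mul_pow_succ_ne_zero hq (ha s) n) (n + 1)
  rw [overTermOne_succ, truncatedProd, truncatedProd, qPochRatio_succ]
  rw [sum_range_succ (fun k ↦ qBinomProdCoeff q a k * (q ^ (n + 1)) ^ k) (n + 1)] at h
  simp only [mul_add, mul_one, sum_add_distrib]
  rw [← qBinomProdCoeff, sq, pow_mul, pow_succ' q (n + 1)]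
  linear_combination (-qPochRatio q a n) * h

theorem norm_qBinomCoeff_le {q a : ℂ} (hq : ‖q‖ < 1) (ha : ‖a‖ < 1) (n : ℕ) :
    ‖qBinomCoeff q a n‖ ≤ (2 / (1 - ‖q‖)) ^ n := by
  have hq' : 0 < 1 - ‖q‖ := by linarith
  induction n with
  | zero => simp [qBinomCoeff, qPoch]
  | succ n ih =>
    have h1 : 1 - ‖q‖ ≤ ‖1 - q ^ (n + 1)‖ := by
      have h := norm_sub_norm_le 1 (q ^ (n + 1))
      have h' : ‖q‖ ^ (n + 1) ≤ ‖q‖ := pow_le_of_le_one (norm_nonneg q) hq.le n.succ_ne_zero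
      rw [norm_one, norm_pow] at h
      linarith
    have h2 : ‖1 + q ^ n‖ ≤ 2 := by
      have h := norm_add_le 1 (q ^ n)
      have h' := pow_le_one₀ (n := n) (norm_nonneg q) hq.le
      rw [norm_one, norm_pow] at h
      linarith
    have h3 := congrArg norm (qBinomCoeff_succ hq a n)
    simp only [norm_mul] at h3
    rw [pow_succ, mul_div_assoc', le_div_iff₀ hq']
    calc ‖qBinomCoeff q a (n + 1)‖ * (1 - ‖q‖)
        ≤ ‖qBinomCoeff q a (n + 1)‖ * ‖1 - q ^ (n + 1)‖ := by gcongr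
      _ = ‖qBinomCoeff q a n‖ * (‖a‖ * ‖1 + q ^ n‖) := h3
      _ ≤ (2 / (1 - ‖q‖)) ^ n * (1 * 2) := by gcongr
      _ = (2 / (1 - ‖q‖)) ^ n * 2 := by ring

theorem norm_prod_qBinomCoeff_le {r : ℕ} {q : ℂ} (hq : ‖q‖ < 1) {a : Fin r → ℂ}
    (ha : ∀ j, ‖a j‖ < 1) (i : Fin r → ℕ) :
    ‖∏ t, qBinomCoeff q (a t) (i t)‖ ≤ (2 / (1 - ‖q‖)) ^ (∑ t, i t) := by
  rw [norm_prod, ← prod_pow_eq_pow_sum]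
  exact prod_le_prod (fun _ _ ↦ norm_nonneg _) fun t _ ↦ norm_qBinomCoeff_le hq (ha t) _

theorem card_antidiagonalTuple_le (r n : ℕ) : #(Nat.antidiagonalTuple r n) ≤ (2 ^ r) ^ n := by
  have h : Nat.antidiagonalTuple r n ⊆ Fintype.piFinset fun _ ↦ range (n + 1) := by
    intro i hi
    rw [Nat.mem_antidiagonalTuple] at hi
    rw [Fintype.mem_piFinset]
    intro t
    have := single_le_sum (fun t _ ↦ Nat.zero_le (i t)) (mem_univ t)
    rw [mem_range]
    omega
  calc #(Nat.antidiagonalTuple r n) ≤ (n + 1) ^ r := by simpa using card_le_card h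
    _ ≤ (2 ^ n) ^ r := Nat.pow_le_pow_left n.lt_two_pow_self r
    _ = (2 ^ r) ^ n := by rw [← pow_mul, ← pow_mul, mul_comm]

theorem norm_sum_antidiagonalTuple_le {r : ℕ} {q : ℂ} (hq : ‖q‖ < 1) {a : Fin r → ℂ}
    (ha : ∀ j, ‖a j‖ < 1) (n : ℕ) {g : (Fin r → ℕ) → ℂ} {E : ℝ} (hE : 0 ≤ E)
    (hg : ∀ i, ‖g i‖ ≤ E) :
    ‖∑ i ∈ Nat.antidiagonalTuple r n, (∏ t, qBinomCoeff q (a t) (i t)) * g i‖ ≤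
      (2 ^ r * (2 / (1 - ‖q‖))) ^ n * E := by
  have hq' : 0 < 1 - ‖q‖ := by linarith
  have h : ∀ i ∈ Nat.antidiagonalTuple r n, ‖(∏ t, qBinomCoeff q (a t) (i t)) * g i‖ ≤
      (2 / (1 - ‖q‖)) ^ n * E := by
    intro i hi
    have h := norm_prod_qBinomCoeff_le hq ha i
    rw [Nat.mem_antidiagonalTuple.1 hi] at h
    rw [norm_mul]
    gcongr
    exact hg i
  have hc : (#(Nat.antidiagonalTuple r n) : ℝ) ≤ (2 ^ r) ^ n := by
    exact_mod_cast card_antidiagonalTuple_le r n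
  refine (norm_sum_le_of_le _ h).trans ?_
  rw [sum_const, nsmul_eq_mul, mul_pow, mul_assoc]
  gcongr

theorem norm_qBinomProdCoeff_le {r : ℕ} {q : ℂ} (hq : ‖q‖ < 1) {a : Fin r → ℂ}
    (ha : ∀ j, ‖a j‖ < 1) (n : ℕ) :
    ‖qBinomProdCoeff q a n‖ ≤ (2 ^ r * (2 / (1 - ‖q‖))) ^ n := by
  simpa [qBinomProdCoeff] using
    norm_sum_antidiagonalTuple_le hq ha n (g := fun _ ↦ 1) zero_le_one (by simp)

theorem norm_corr_le {r : ℕ} {q : ℂ} (hq : ‖q‖ < 1) {a : Fin r → ℂ}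
    (ha : ∀ j, ‖a j‖ < 1) (i : Fin r → ℕ) (n : ℕ) :
    ‖corr q a i (q ^ (n + 1))‖ ≤ r * (2 * (2 / (1 - ‖q‖)) * (2 / (1 - ‖q‖)) ^ r) := by
  have hq' : 0 < 1 - ‖q‖ := by linarith
  have hB : 1 ≤ 2 / (1 - ‖q‖) := by
    rw [le_div_iff₀ hq']; linarith [norm_nonneg q]
  have hden (s : Fin r) : 1 - ‖q‖ ≤ ‖1 - a s * q ^ (n + 1)‖ := by
    have h := norm_sub_norm_le 1 (a s * q ^ (n + 1))
    rw [norm_one] at h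
    linarith [norm_mul_pow_succ_le hq (ha s) n]
  have hpow (m : ℕ) : ‖q ^ m‖ ≤ 1 := by
    rw [norm_pow]; exact pow_le_one₀ (norm_nonneg q) hq.le
  have hterm (s : Fin r) : ‖q ^ (∑ t ∈ Iio s, i t) * (1 + q ^ i s) *
      (a s * q ^ (n + 1) / (1 - a s * q ^ (n + 1))) *
      ∏ k ∈ Iio s, (1 + a k * q ^ (n + 1)) / (1 - a k * q ^ (n + 1))‖ ≤
      1 * 2 * (2 / (1 - ‖q‖)) * (2 / (1 - ‖q‖)) ^ r := by
    have h1 : ‖1 + q ^ i s‖ ≤ 2 := by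
      have h := norm_add_le 1 (q ^ i s)
      rw [norm_one] at h
      linarith [hpow (i s)]
    have h2 : ‖a s * q ^ (n + 1)‖ ≤ 2 := by linarith [norm_mul_pow_succ_le hq (ha s) n]
    have h3 : ∏ k ∈ Iio s, ‖1 + a k * q ^ (n + 1)‖ / ‖1 - a k * q ^ (n + 1)‖ ≤
        (2 / (1 - ‖q‖)) ^ r := by
      calc _ ≤ ∏ k ∈ Iio s, 2 / (1 - ‖q‖) := by
            refine prod_le_prod (fun _ _ ↦ by positivity) fun k _ ↦ ?_
            have h := norm_add_le 1 (a k * q ^ (n + 1))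
            rw [norm_one] at h
            have h' : ‖1 + a k * q ^ (n + 1)‖ ≤ 2 := by
              linarith [norm_mul_pow_succ_le hq (ha k) n]
            gcongr
            exact hden k
        _ = (2 / (1 - ‖q‖)) ^ #(Iio s) := prod_const _
        _ ≤ _ := pow_le_pow_right₀ hB ((card_le_univ _).trans_eq (Fintype.card_fin r))
    rw [norm_mul, norm_mul, norm_mul, norm_div, norm_prod]
    simp only [norm_div]
    gcongr
    · exact hpow _
    · exact hden s
  refine (norm_sum_le_of_le _ fun s _ ↦ hterm s).trans_eq ?_
  simp

theorem summable_norm_mul_pow {q : ℂ} (hq : ‖q‖ < 1) (c : ℂ) :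
    Summable fun k : ℕ ↦ ‖c * q ^ k‖ := by
  simp only [norm_mul, norm_pow]
  exact (summable_geometric_of_lt_one (norm_nonneg q) hq).mul_left _

theorem tendsto_qPoch {q : ℂ} (hq : ‖q‖ < 1) (c : ℂ) :
    Tendsto (qPoch c q) atTop (𝓝 (qPochInf c q)) := by
  have h : Multipliable fun k : ℕ ↦ 1 + -(c * q ^ k) :=
    multipliable_one_add_of_summable (by simpa using summable_norm_mul_pow hq c)
  simp only [← sub_eq_add_neg] at h
  exact h.hasProd.tendsto_prod_nat

theorem qPochInf_mul_ne_zero {q a : ℂ} (hq : ‖q‖ < 1) (ha : ‖a‖ < 1) :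
    qPochInf (a * q) q ≠ 0 := by
  have h := tprod_one_add_ne_zero_of_summable (f := fun k : ℕ ↦ -(a * q * q ^ k))
    (fun k ↦ by
      rw [← sub_eq_add_neg, mul_assoc, ← pow_succ']
      exact one_sub_mul_pow_succ_ne_zero hq ha k)
    (by simpa using summable_norm_mul_pow hq (a * q))
  simpa [qPochInf, sub_eq_add_neg] using h

theorem tendsto_qPochRatio {r : ℕ} {q : ℂ} (hq : ‖q‖ < 1) {a : Fin r → ℂ}
    (ha : ∀ j, ‖a j‖ < 1) :
    Tendsto (qPochRatio q a) atTop
      (𝓝 (∏ j, qPochInf (-a j * q) q / qPochInf (a j * q) q)) :=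
  tendsto_finsetProd _ fun j _ ↦
    (tendsto_qPoch hq _).div (tendsto_qPoch hq _) (qPochInf_mul_ne_zero hq (ha j))

theorem qBinomProdCoeff_zero {r : ℕ} (q : ℂ) (a : Fin r → ℂ) : qBinomProdCoeff q a 0 = 1 := by
  simp [qBinomProdCoeff, Nat.antidiagonalTuple_zero_right, qBinomCoeff, qPoch]

theorem tendsto_const_mul_pow_succ {c : ℝ} (hc : 0 ≤ c) (hc' : c < 1) (D : ℝ) :
    Tendsto (fun n : ℕ ↦ D * c ^ (n + 1)) atTop (𝓝 0) := by
  simpa using ((tendsto_add_atTop_iff_nat 1).2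
    (tendsto_pow_atTop_nhds_zero_of_lt_one hc hc')).const_mul D

theorem tendsto_truncatedProd {r : ℕ} {q : ℂ} (hq : ‖q‖ < 1) {a : Fin r → ℂ}
    (ha : ∀ j, ‖a j‖ < 1) :
    Tendsto (truncatedProd q a) atTop
      (𝓝 (∏ j, qPochInf (-a j * q) q / qPochInf (a j * q) q)) := by
  have hq' : 0 < 1 - ‖q‖ := by linarith
  set D : ℝ := 2 ^ r * (2 / (1 - ‖q‖))
  have hD0 : 0 ≤ D := by positivity
  have h0 : Tendsto (fun n : ℕ ↦ ∑ k ∈ range n,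
      qBinomProdCoeff q a (k + 1) * (q ^ (n + 1)) ^ (k + 1)) atTop (𝓝 0) := by
    have hlim : Tendsto (fun n : ℕ ↦ D * ‖q‖ * (n * ‖q‖ ^ n)) atTop (𝓝 0) := by
      simpa using (tendsto_self_mul_const_pow_of_lt_one (norm_nonneg q) hq).const_mul (D * ‖q‖)
    refine squeeze_zero_norm' ?_ hlim
    filter_upwards [(tendsto_const_mul_pow_succ (norm_nonneg q) hq D).eventually_le_const
      zero_lt_one] with n hn
    have hterm : ∀ k ∈ range n, ‖qBinomProdCoeff q a (k + 1) * (q ^ (n + 1)) ^ (k + 1)‖ ≤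
        D * ‖q‖ ^ (n + 1) := by
      intro k _
      rw [norm_mul, norm_pow, norm_pow]
      calc _ ≤ D ^ (k + 1) * (‖q‖ ^ (n + 1)) ^ (k + 1) := by
            gcongr; exact norm_qBinomProdCoeff_le hq ha _
        _ = (D * ‖q‖ ^ (n + 1)) ^ (k + 1) := (mul_pow _ _ _).symm
        _ ≤ _ := pow_le_of_le_one (by positivity) hn k.succ_ne_zero
    refine (norm_sum_le_of_le _ hterm).trans_eq ?_
    rw [sum_const, card_range, nsmul_eq_mul]
    ring
  have h1 := (tendsto_qPochRatio hq ha).mul (h0.add_const 1)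
  rw [zero_add, mul_one] at h1
  refine h1.congr fun n ↦ ?_
  rw [truncatedProd, sum_range_succ', qBinomProdCoeff_zero]
  simp

theorem summable_norm_overTermOne {r : ℕ} {q : ℂ} (hq : ‖q‖ < 1) {a : Fin r → ℂ}
    (ha : ∀ j, ‖a j‖ < 1) :
    Summable fun n : ℕ ↦ ‖overTermOne r q a (n + 1)‖ := by
  have hq' : 0 < 1 - ‖q‖ := by linarith
  set D : ℝ := 2 ^ r * (2 / (1 - ‖q‖))
  have hD0 : 0 ≤ D := by positivity
  obtain ⟨K, hK⟩ := (tendsto_qPochRatio hq ha).norm.bddAbove_range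
  have hK (n : ℕ) : ‖qPochRatio q a n‖ ≤ K := hK ⟨n, rfl⟩
  have hK0 : 0 ≤ K := (norm_nonneg _).trans (hK 0)
  set E : ℝ := 1 + r * (2 * (2 / (1 - ‖q‖)) * (2 / (1 - ‖q‖)) ^ r)
  have hE0 : 0 ≤ E := by positivity
  have hgeom : Summable fun n : ℕ ↦ (1 / 2 : ℝ) ^ (n + 1) * (K * E) :=
    ((summable_nat_add_iff 1).2 summable_geometric_two).mul_right _
  refine hgeom.of_norm_bounded_eventually_nat ?_
  filter_upwards [(tendsto_const_mul_pow_succ (norm_nonneg q) hq D).eventually_le_const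
    one_half_pos] with n hn
  have hsum := norm_sum_antidiagonalTuple_le hq ha (n + 1)
    (g := fun i ↦ 1 + corr q a i (q ^ (n + 1))) hE0 fun i ↦ by
      refine (norm_add_le _ _).trans ?_
      rw [norm_one]
      exact add_le_add_right (norm_corr_le hq ha i n) 1
  rw [norm_norm, overTermOne_succ, norm_mul, norm_mul, norm_pow]
  calc _ ≤ ‖q‖ ^ ((n + 1) ^ 2) * K * (D ^ (n + 1) * E) := by
        gcongr; exact hK n
    _ = (D * ‖q‖ ^ (n + 1)) ^ (n + 1) * (K * E) := by
        rw [sq, pow_mul, mul_pow]; ring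
    _ ≤ _ := by gcongr

/-- Theorem 1.2 specialized at `z_j = 1`: a multi-dimensional generalization of the
Dousse–Kim identity. -/
theorem multidim_dousse_kim (r : ℕ) (hr : 1 ≤ r) (q : ℂ) (hq0 : 0 < ‖q‖) (hq : ‖q‖ < 1)
    (a : Fin r → ℂ) (ha : ∀ j, ‖a j‖ < 1) :
    Summable (fun N : ℕ => ‖overTermOne r q a (N + 1)‖) ∧
    (∏ j : Fin r, qPochInf (-a j * q) q / qPochInf (a j * q) q) =
      1 + ∑' N : ℕ, overTermOne r q a (N + 1) := by
  have hs := summable_norm_overTermOne hq ha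
  refine ⟨hs, ?_⟩
  have h := hs.of_norm.hasSum.tendsto_sum_nat
  simp only [overTermOne_succ_eq_sub hq ha, sum_range_sub (truncatedProd q a)] at h
  have h0 : truncatedProd q a 0 = 1 := by
    simp [truncatedProd, qPochRatio, qPoch, qBinomProdCoeff_zero]
  rw [h0] at h
  have h' := tendsto_nhds_unique h ((tendsto_truncatedProd hq ha).sub_const 1)
  simp only [overTermOne_succ_eq_sub hq ha, h', add_sub_cancel]
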